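/- arXiv:0808.2748 — 2 statements merged into one kernel-verified Lean document; each statement's English description precedes it below -/
import Mathlib

section
/- Let m ≥ 1 and p ≥ 1 be integers, and let z_1, ..., z_p be complex numbers (not necessarily distinct). Set A(X) = ∏_{i=1}^{p} (X - z_i) ∈ ℂ[X]. Then A(X) divides the polynomial E(X) = ∏_{i=1}^{p} ( P_m(z_i) * Q_m(X) - Q_m(z_i) * P_m(X) ) in ℂ[X], where P_m(x) = Σ_{j=0}^{⌊m/2⌋} (-1)^j * binom(m, 2j) * x^{m-2j} and Q_m(x) = Σ_{j=0}^{⌊(m-1)/2⌋} (-1)^j * binom(m, 2j+1) * x^{m-2j-1}. -/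
open Polynomial Finset

/-- The polynomial `P_m(x) = Σ_{j=0}^{⌊m/2⌋} (-1)^j C(m,2j) x^{m-2j}` over `ℂ`. -/
noncomputable def landenP (m : ℕ) : Polynomial ℂ :=
  ∑ j ∈ Finset.range (m / 2 + 1),
    Polynomial.C ((-1 : ℂ) ^ j * (m.choose (2 * j) : ℂ)) * Polynomial.X ^ (m - 2 * j)

/-- The polynomial `Q_m(x) = Σ_{j=0}^{⌊(m-1)/2⌋} (-1)^j C(m,2j+1) x^{m-2j-1}` over `ℂ`. -/
noncomputable def landenQ (m : ℕ) : Polynomial ℂ :=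
  ∑ j ∈ Finset.range ((m - 1) / 2 + 1),
    Polynomial.C ((-1 : ℂ) ^ j * (m.choose (2 * j + 1) : ℂ))
      * Polynomial.X ^ (m - (2 * j + 1))

theorem A_dvd_E (m p : ℕ) (hm : 1 ≤ m) (hp : 1 ≤ p) (z : Fin p → ℂ) :
    (∏ i, (Polynomial.X - Polynomial.C (z i))) ∣
      ∏ i, (Polynomial.C ((landenP m).eval (z i)) * landenQ m
        - Polynomial.C ((landenQ m).eval (z i)) * landenP m) := by
  refine Finset.prod_dvd_prod_of_dvd _ _ fun i _ => ?_
  rw [Polynomial.dvd_iff_isRoot]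
  simp [mul_comm]
end

section
/- Let m ≥ 2 be an integer and let z be a complex number with nonzero imaginary part. Then Q_m(z) ≠ 0, where Q_m(x) = Σ_{j=0}^{⌊(m-1)/2⌋} (-1)^j * binom(m, 2j+1) * x^{m-2j-1}. Consequently, if A ∈ ℝ[X] has degree p ≥ 1 and no real roots, with complex roots z_1, ..., z_p (with multiplicity), then the polynomial H(x) = ∏_{i=1}^{p} ( P_m(z_i) - x * Q_m(z_i) ) has degree exactly p in x, where P_m(x) = Σ_{j=0}^{⌊m/2⌋} (-1)^j * binom(m, 2j) * x^{m-2j}. -/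
open Polynomial Finset

theorem sum_range_two_mul_eq_sum_pairs {M : Type*} [AddCommMonoid M] (f : ℕ → M) (n : ℕ) :
    ∑ k ∈ Finset.range (2 * n), f k =
      ∑ j ∈ Finset.range n, (f (2 * j) + f (2 * j + 1)) := by
  induction n with
  | zero => simp
  | succ n ih =>
    rw [Nat.mul_succ, Finset.sum_range_succ, Finset.sum_range_succ, ih, Finset.sum_range_succ,
      add_assoc]

theorem two_mul_I_mul_eval_landenQ (m : ℕ) (z : ℂ) :
    2 * Complex.I * (landenQ m).eval z = (z + Complex.I) ^ m - (z - Complex.I) ^ m := by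
  have expand (w : ℂ) : (w + z) ^ m = ∑ k ∈ Finset.range (2 * (m + 1)),
      w ^ k * z ^ (m - k) * (m.choose k : ℂ) := by
    rw [add_pow]
    refine Finset.sum_subset (Finset.range_subset_range.2 (by lia)) fun k _ hk ↦ ?_
    rw [Nat.choose_eq_zero_of_lt (by simpa using hk)]
    simp
  have hQ : (landenQ m).eval z = ∑ j ∈ Finset.range (m + 1),
      (-1 : ℂ) ^ j * (m.choose (2 * j + 1) : ℂ) * z ^ (m - (2 * j + 1)) := by
    simp only [landenQ, eval_finsetSum, eval_mul, eval_C, eval_pow, eval_X]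
    refine Finset.sum_subset (Finset.range_subset_range.2 (by lia)) fun j _ hj ↦ ?_
    rw [Finset.mem_range] at hj
    rw [Nat.choose_eq_zero_of_lt (by lia)]
    simp
  rw [add_comm z, show z - Complex.I = -Complex.I + z from sub_eq_neg_add _ _, expand, expand,
    ← Finset.sum_sub_distrib, sum_range_two_mul_eq_sum_pairs, hQ, Finset.mul_sum]
  refine Finset.sum_congr rfl fun j _ ↦ ?_
  simp only [pow_succ _ (2 * j), pow_mul, neg_sq, Complex.I_sq]
  ring

theorem eval_landenQ_ne_zero {m : ℕ} (hm : m ≠ 0) {z : ℂ} (hz : z.im ≠ 0) :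
    (landenQ m).eval z ≠ 0 := by
  intro h
  have hpow : (z + Complex.I) ^ m = (z - Complex.I) ^ m := by
    rw [← sub_eq_zero, ← two_mul_I_mul_eval_landenQ, h, mul_zero]
  have hnorm : ‖z + Complex.I‖ = ‖z - Complex.I‖ := by
    refine (pow_left_inj₀ (norm_nonneg _) (norm_nonneg _) hm).1 ?_
    rw [← norm_pow, ← norm_pow, hpow]
  have hsq : Complex.normSq (z + Complex.I) = Complex.normSq (z - Complex.I) := by
    rw [Complex.normSq_eq_norm_sq, Complex.normSq_eq_norm_sq, hnorm]
  simp only [Complex.normSq_apply, Complex.add_re, Complex.add_im, Complex.sub_re,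
    Complex.sub_im, Complex.I_re, Complex.I_im] at hsq
  exact hz (by linarith)

theorem natDegree_prod_C_sub_X_mul_C {R ι : Type*} [CommRing R] [IsDomain R] [Fintype ι]
    (a b : ι → R) (hb : ∀ i, b i ≠ 0) :
    (∏ i, (C (a i) - X * C (b i))).natDegree = Fintype.card ι := by
  have hdeg (i : ι) : (C (a i) - X * C (b i)).natDegree = 1 := by
    rw [show C (a i) - X * C (b i) = C (-b i) * X + C (a i) by rw [C_neg]; ring]
    exact natDegree_linear (neg_ne_zero.2 (hb i))
  rw [natDegree_prod _ _ fun i _ ↦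
    ne_zero_of_natDegree_gt (n := 0) (by rw [hdeg i]; exact one_pos)]
  simp only [hdeg, Finset.sum_const, Finset.card_univ, smul_eq_mul, mul_one]

theorem Qm_ne_zero_off_real_axis_and_H_degree (m : ℕ) (hm : 2 ≤ m)
    (z : ℂ) (hz : z.im ≠ 0) :
    (landenQ m).eval z ≠ 0 ∧
    ∀ (p : ℕ) (A : Polynomial ℝ) (zs : Fin p → ℂ),
      1 ≤ p → A.natDegree = p → (∀ x : ℝ, A.eval x ≠ 0) →
      A.map (algebraMap ℝ ℂ)
        = Polynomial.C ((algebraMap ℝ ℂ) A.leadingCoeff)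
            * ∏ i, (Polynomial.X - Polynomial.C (zs i)) →
      (∏ i, (Polynomial.C ((landenP m).eval (zs i))
        - Polynomial.X * Polynomial.C ((landenQ m).eval (zs i)))).natDegree = p := by
  have hm0 : m ≠ 0 := by lia
  refine ⟨eval_landenQ_ne_zero hm0 hz, fun p A zs _ _ hA hfac ↦ ?_⟩
  have him (i : Fin p) : (zs i).im ≠ 0 := by
    intro him
    obtain ⟨x, hx⟩ : ∃ x : ℝ, (algebraMap ℝ ℂ) x = zs i := ⟨(zs i).re, Complex.ext rfl him.symm⟩
    apply hA x
    have hroot : (A.map (algebraMap ℝ ℂ)).eval (zs i) = 0 := by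
      rw [hfac, eval_mul, eval_prod, Finset.prod_eq_zero (Finset.mem_univ i) (by simp), mul_zero]
    rw [← hx, eval_map_apply] at hroot
    exact (map_eq_zero _).1 hroot
  rw [natDegree_prod_C_sub_X_mul_C _ _ fun i ↦ eval_landenQ_ne_zero hm0 (him i), Fintype.card_fin]
end
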